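/- Assume Hypothesis (H) and let p be a prime such that p divides |K|, p does not divide c, and p > λ, where K is the kernel of the action of G on the class partition C. Let P be a Sylow p-subgroup of K, let fix(P) ⊆ P be the set of points fixed by P, and let B₀ = {B ∈ B : B ⊆ fix(P)}. Then there is an integer f with ℓ < f < c and c ≡ f (mod p) such that P fixes exactly f points in every class Δ ∈ C, the pair (fix(P), B₀) is a 2-(df, k, λ) design, and in particular k − 1 divides λ(df − 1). -/

import Mathlib

open scoped Pointwise

/-- A `p`-group leaving invariant a finite set with fewer than `p` elements fixes it pointwise. -/
theorem IsPGroup.smul_eq_of_card_lt {p : ℕ} (hp : p.Prime) {H X : Type*} [Group H] [Finite H]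
    [MulAction H X] (hH : IsPGroup p H) (S : Finset X) (hS : ∀ g : H, ∀ x ∈ S, g • x ∈ S)
    (hcard : S.card < p) {x : X} (hx : x ∈ S) (g : H) : g • x = x := by
  have := Fact.mk hp
  have hsub : MulAction.orbit H x ⊆ (S : Set X) := by
    rintro _ ⟨h, rfl⟩
    exact hS h x hx
  have : Finite (MulAction.orbit H x) := S.finite_toSet.subset hsub
  obtain ⟨n, hn⟩ := hH.card_orbit x
  have hle : Nat.card (MulAction.orbit H x) ≤ S.card := by
    have := Set.ncard_le_ncard hsub S.finite_toSet
    rwa [Set.ncard_coe_finset] at this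
  have hn0 : n = 0 := by
    by_contra h0
    have := Nat.le_self_pow h0 p
    omega
  rw [hn0, pow_zero] at hn
  have hss := (Nat.card_eq_one_iff_unique.mp hn).1
  exact congrArg Subtype.val
    (hss.elim ⟨g • x, MulAction.mem_orbit x g⟩ ⟨x, MulAction.mem_orbit_self x⟩)

/-- A `p`-group leaving invariant a finite set of size prime to `p` fixes a point of it. -/
theorem IsPGroup.exists_fixed_mem_of_not_dvd_card {p : ℕ} (hp : p.Prime) {H X : Type*} [Group H]
    [MulAction H X] (hH : IsPGroup p H) (S : Finset X) (hS : ∀ g : H, ∀ x ∈ S, g • x ∈ S)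
    (hcard : ¬ p ∣ S.card) : ∃ x ∈ S, ∀ g : H, g • x = x := by
  have := Fact.mk hp
  let T : SubMulAction H X := ⟨(S : Set X), fun g {x} hx => hS g x hx⟩
  have hT : Nat.card T = S.card := by
    change Nat.card (S : Set X) = S.card
    simp
  have : Finite T := S.finite_toSet
  obtain ⟨x, hx⟩ := hH.nonempty_fixed_point_of_prime_not_dvd_card T (by rwa [hT])
  exact ⟨x, x.2, fun g => congrArg Subtype.val (hx g)⟩

section Counting

variable {Ω : Type*} [DecidableEq Ω]

/-- Counting the flags `(β, B)` with `β ∈ S \ {α}` and `α, β ∈ B` in two ways. -/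
theorem card_blocks_through_mul (𝓐 : Finset (Finset Ω)) (S : Finset Ω) (lam m : ℕ) {α : Ω}
    (hα : α ∈ S)
    (hpairs : ∀ β ∈ S, α ≠ β → (𝓐.filter (fun B => α ∈ B ∧ β ∈ B)).card = lam)
    (hm : ∀ B ∈ 𝓐, α ∈ B → (B ∩ S).card = m) :
    lam * (S.card - 1) = (𝓐.filter (fun B => α ∈ B)).card * (m - 1) := by
  have h := Finset.sum_card_bipartiteAbove_eq_sum_card_bipartiteBelow
    (s := S.erase α) (t := 𝓐.filter (fun B => α ∈ B)) (fun β B => β ∈ B)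
  rw [Finset.sum_const_nat (m := lam), Finset.sum_const_nat (m := m - 1),
    Finset.card_erase_of_mem hα] at h
  · rw [mul_comm, h]
  · intro B hB
    rw [Finset.mem_filter] at hB
    rw [← hm B hB.1 hB.2, ← Finset.card_erase_of_mem (Finset.mem_inter.2 ⟨hB.2, hα⟩)]
    congr 1
    ext β
    simp only [Finset.bipartiteBelow, Finset.mem_filter, Finset.mem_erase, Finset.mem_inter]
    tauto
  · intro β hβ
    rw [Finset.mem_erase] at hβ
    rw [← hpairs β hβ.2 hβ.1.symm, Finset.bipartiteAbove, Finset.filter_filter]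

/-- If the blocks of a `2`-design on `F` meet the cells of a partition of `F` into `|𝓒|` nonempty
cells in `0` or `ℓ` points, then each cell size `f` satisfies `f (k - 1 - |𝓒| (ℓ - 1)) = k - ℓ`. -/
theorem cell_card_mul (𝓐 𝓒 : Finset (Finset Ω)) (F : Finset Ω) (k lam ℓ : ℕ)
    (hlam : 1 ≤ lam) (hk : 2 ≤ k) (hl : 1 ≤ ℓ)
    (hkcard : ∀ B ∈ 𝓐, B.card = k) (hsub : ∀ B ∈ 𝓐, B ⊆ F)
    (hpairs : ∀ α ∈ F, ∀ β ∈ F, α ≠ β → (𝓐.filter (fun B => α ∈ B ∧ β ∈ B)).card = lam)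
    (hpart : ∀ ω : Ω, ∃! Δ, Δ ∈ 𝓒 ∧ ω ∈ Δ)
    (hlcap : ∀ B ∈ 𝓐, ∀ Δ ∈ 𝓒, (B ∩ Δ).Nonempty → (B ∩ Δ).card = ℓ)
    (hne : ∀ Δ ∈ 𝓒, (F ∩ Δ).Nonempty) {Δ : Finset Ω} (hΔ : Δ ∈ 𝓒) :
    ((F ∩ Δ).card : ℤ) * ((k : ℤ) - 1 - 𝓒.card * ((ℓ : ℤ) - 1)) = (k : ℤ) - ℓ := by
  have key : ∀ Γ ∈ 𝓒, (((F ∩ Γ).card : ℤ) - 1) * ((k : ℤ) - 1)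
      = ((F.card : ℤ) - 1) * ((ℓ : ℤ) - 1) := by
    intro Γ hΓ
    obtain ⟨α, hα⟩ := hne Γ hΓ
    obtain ⟨hαF, hαΓ⟩ := Finset.mem_inter.1 hα
    have h1 := card_blocks_through_mul 𝓐 F lam k hαF (hpairs α hαF)
      (fun B hB _ => by rw [Finset.inter_eq_left.2 (hsub B hB), hkcard B hB])
    have h2 := card_blocks_through_mul 𝓐 (F ∩ Γ) lam ℓ hα
      (fun β hβ => hpairs α hαF β (Finset.mem_inter.1 hβ).1)
      (fun B hB hαB => by
        rw [← Finset.inter_assoc, Finset.inter_eq_left.2 (hsub B hB)]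
        exact hlcap B hB Γ hΓ ⟨α, Finset.mem_inter.2 ⟨hαB, hαΓ⟩⟩)
    have hF1 : 1 ≤ F.card := Finset.card_pos.2 ⟨α, hαF⟩
    have hG1 : 1 ≤ (F ∩ Γ).card := Finset.card_pos.2 ⟨α, hα⟩
    zify [hF1, hG1, hl, (by omega : 1 ≤ k)] at h1 h2
    have hlam0 : (lam : ℤ) ≠ 0 := by positivity
    apply mul_left_cancel₀ hlam0
    linear_combination ((k : ℤ) - 1) * h2 - ((ℓ : ℤ) - 1) * h1
  have hconst : ∀ Γ ∈ 𝓒, (F ∩ Γ).card = (F ∩ Δ).card := by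
    intro Γ hΓ
    have hk0 : (k : ℤ) - 1 ≠ 0 := by omega
    have := mul_right_cancel₀ hk0 ((key Γ hΓ).trans (key Δ hΔ).symm)
    omega
  have hF : F.card = 𝓒.card * (F ∩ Δ).card := by
    have hdisj : (𝓒 : Set (Finset Ω)).PairwiseDisjoint (fun Γ => F ∩ Γ) := by
      intro Γ₁ h₁ Γ₂ h₂ hne'
      refine Finset.disjoint_left.2 fun ω hω₁ hω₂ => hne' ?_
      exact (hpart ω).unique ⟨h₁, (Finset.mem_inter.1 hω₁).2⟩ ⟨h₂, (Finset.mem_inter.1 hω₂).2⟩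
    rw [← Finset.sum_const_nat hconst, ← Finset.card_biUnion hdisj]
    congr 1
    ext ω
    obtain ⟨Γ, hΓ, -⟩ := hpart ω
    simp only [Finset.mem_biUnion, Finset.mem_inter]
    exact ⟨fun h => ⟨Γ, hΓ.1, h, hΓ.2⟩, fun ⟨_, _, h, _⟩ => h⟩
  have h := key Δ hΔ
  rw [hF] at h
  push_cast at h
  linear_combination h

/-- Fisher's inequality: a `2`-design with `lam < r` has at least as many blocks as points. -/
theorem card_points_le_card_blocks [Fintype Ω] (𝓑 : Finset (Finset Ω)) (r lam : ℕ)
    (hr : ∀ α, (𝓑.filter (fun B => α ∈ B)).card = r)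
    (hpairs : ∀ α β : Ω, α ≠ β → (𝓑.filter (fun B => α ∈ B ∧ β ∈ B)).card = lam)
    (hlt : lam < r) : Fintype.card Ω ≤ 𝓑.card := by
  let L : (Ω → ℝ) →ₗ[ℝ] (𝓑 → ℝ) :=
    { toFun := fun a B => ∑ ω, if ω ∈ B.1 then a ω else 0
      map_add' := by
        intro a b
        ext B
        simp only [Pi.add_apply, ← Finset.sum_add_distrib]
        exact Finset.sum_congr rfl fun ω _ => by split_ifs <;> simp
      map_smul' := by
        intro t a
        ext B
        simp [Finset.mul_sum] }
  have hnorm : ∀ a : Ω → ℝ, ∑ B : 𝓑, (L a B) ^ 2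
      = ((r : ℝ) - lam) * ∑ ω, a ω ^ 2 + lam * (∑ ω, a ω) ^ 2 := by
    intro a
    have h1 : ∑ B : 𝓑, (L a B) ^ 2 = ∑ α, ∑ β, a α * a β *
        ((𝓑.filter (fun B => α ∈ B ∧ β ∈ B)).card : ℝ) := by
      have : ∀ B : 𝓑, (L a B) ^ 2
          = ∑ α, ∑ β, a α * a β * (if α ∈ B.1 ∧ β ∈ B.1 then 1 else 0) := by
        intro B
        change (∑ ω, if ω ∈ B.1 then a ω else 0) ^ 2 = _
        rw [sq, Finset.sum_mul_sum]
        refine Finset.sum_congr rfl fun α _ => Finset.sum_congr rfl fun β _ => ?_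
        by_cases hα : α ∈ B.1 <;> by_cases hβ : β ∈ B.1 <;> simp [hα, hβ]
      simp_rw [this]
      rw [Finset.sum_comm]
      refine Finset.sum_congr rfl fun α _ => ?_
      rw [Finset.sum_comm]
      refine Finset.sum_congr rfl fun β _ => ?_
      rw [← Finset.mul_sum, Finset.sum_coe_sort 𝓑
        (fun B => if α ∈ B ∧ β ∈ B then (1 : ℝ) else 0), Finset.sum_boole]
    have h2 : ∀ α β : Ω, a α * a β * ((𝓑.filter (fun B => α ∈ B ∧ β ∈ B)).card : ℝ)
        = (if α = β then ((r : ℝ) - lam) * (a α * a β) else 0) + lam * (a α * a β) := by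
      intro α β
      by_cases h : α = β
      · subst h
        simp only [and_self, hr, if_true]
        ring
      · rw [hpairs α β h, if_neg h]
        ring
    rw [h1]
    simp_rw [h2, Finset.sum_add_distrib]
    rw [sq (∑ ω, a ω), Finset.sum_mul_sum]
    simp only [Finset.sum_ite_eq, Finset.mem_univ, if_true, Finset.mul_sum, sq]
  have hinj : Function.Injective L := by
    rw [← LinearMap.ker_eq_bot, LinearMap.ker_eq_bot']
    intro a ha
    have h := hnorm a
    rw [ha] at h
    have hpos : (0 : ℝ) < (r : ℝ) - lam := by
      have : (lam : ℝ) < r := by exact_mod_cast hlt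
      linarith
    have hs : 0 ≤ ∑ ω, a ω ^ 2 := Finset.sum_nonneg fun ω _ => sq_nonneg _
    have hl : 0 ≤ (lam : ℝ) * (∑ ω, a ω) ^ 2 := by positivity
    simp only [Pi.zero_apply, ne_eq, OfNat.ofNat_ne_zero, not_false_eq_true, zero_pow,
      Finset.sum_const_zero] at h
    have h0 : ∑ ω, a ω ^ 2 = 0 := by nlinarith
    ext ω
    have := (Finset.sum_eq_zero_iff_of_nonneg fun ω _ => sq_nonneg (a ω)).1 h0 ω
      (Finset.mem_univ ω)
    simpa using this
  have := LinearMap.finrank_le_finrank_of_injective hinj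
  simpa using this

/-- Fisher's inequality in the form `k ≤ r`. -/
theorem block_card_le_replication [Fintype Ω] (𝓑 : Finset (Finset Ω)) (k r lam : ℕ)
    (hkcard : ∀ B ∈ 𝓑, B.card = k)
    (hr : ∀ α, (𝓑.filter (fun B => α ∈ B)).card = r)
    (hpairs : ∀ α β : Ω, α ≠ β → (𝓑.filter (fun B => α ∈ B ∧ β ∈ B)).card = lam)
    (hlt : lam < r) (hpos : 0 < Fintype.card Ω) : k ≤ r := by
  have hle := card_points_le_card_blocks 𝓑 r lam hr hpairs hlt
  have h := Finset.sum_card_bipartiteAbove_eq_sum_card_bipartiteBelow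
    (s := (Finset.univ : Finset Ω)) (t := 𝓑) (fun β B => β ∈ B)
  simp only [Finset.bipartiteAbove, hr] at h
  rw [Finset.sum_const_nat (fun _ _ => rfl), Finset.sum_const_nat (m := k),
    Finset.card_univ] at h
  · refine Nat.le_of_mul_le_mul_left ?_ hpos
    rw [h]
    exact Nat.mul_le_mul_right k hle
  · intro B hB
    rw [← hkcard B hB]
    congr 1
    ext ω
    simp [Finset.bipartiteBelow]

/-- If the blocks of a nontrivial `2`-design meet the classes of a nontrivial partition into classes
of size `c` in `0` or `ℓ` points, then `ℓ < k` and `ℓ ≤ lam`. -/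
theorem inter_card_lt_and_le [Fintype Ω] (𝓑 𝓒 : Finset (Finset Ω)) (k lam c ℓ : ℕ)
    (hlam : 1 ≤ lam) (hk2 : 2 < k) (hkv : k < Fintype.card Ω)
    (hkcard : ∀ B ∈ 𝓑, B.card = k)
    (hpairs : ∀ α β : Ω, α ≠ β → (𝓑.filter (fun B => α ∈ B ∧ β ∈ B)).card = lam)
    (hpart : ∀ ω : Ω, ∃! Δ, Δ ∈ 𝓒 ∧ ω ∈ Δ) (hd2 : 2 ≤ 𝓒.card)
    (hccard : ∀ Δ ∈ 𝓒, Δ.card = c) (hc2 : 2 ≤ c) (hl2 : 2 ≤ ℓ)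
    (hlcap : ∀ B ∈ 𝓑, ∀ Δ ∈ 𝓒, (B ∩ Δ).Nonempty → (B ∩ Δ).card = ℓ) :
    ℓ < k ∧ ℓ ≤ lam := by
  have hne : ∀ Δ ∈ 𝓒, Δ.Nonempty := fun Δ hΔ =>
    Finset.card_pos.1 (by rw [hccard Δ hΔ]; omega)
  obtain ⟨Δ, hΔ, Γ, hΓ, hΔΓ⟩ := Finset.one_lt_card.1 (show 1 < 𝓒.card by omega)
  obtain ⟨α, hα⟩ := hne Δ hΔ
  obtain ⟨β, hβ⟩ := hne Γ hΓ
  have hβΔ : β ∉ Δ := fun h => hΔΓ ((hpart β).unique ⟨hΔ, h⟩ ⟨hΓ, hβ⟩)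
  have hlk : ℓ < k := by
    have hαβ : α ≠ β := fun h => hβΔ (h ▸ hα)
    obtain ⟨B, hB⟩ := Finset.card_pos.1
      (show 0 < (𝓑.filter (fun B => α ∈ B ∧ β ∈ B)).card by rw [hpairs α β hαβ]; omega)
    obtain ⟨hB, hαB, hβB⟩ := Finset.mem_filter.1 hB
    rw [← hkcard B hB, ← hlcap B hB Δ hΔ ⟨α, Finset.mem_inter.2 ⟨hαB, hα⟩⟩]
    refine Finset.card_lt_card ⟨Finset.inter_subset_left, fun h => hβΔ ?_⟩
    exact (Finset.mem_inter.1 (h hβB)).2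
  refine ⟨hlk, ?_⟩
  have hr1 : ∀ ω : Ω, lam * (Fintype.card Ω - 1)
      = (𝓑.filter (fun B => ω ∈ B)).card * (k - 1) := fun ω =>
    card_blocks_through_mul 𝓑 Finset.univ lam k (Finset.mem_univ ω)
      (fun β _ => hpairs ω β) (fun B hB _ => by rw [Finset.inter_univ, hkcard B hB])
  have hr2 := card_blocks_through_mul 𝓑 Δ lam ℓ hα (fun β _ => hpairs α β)
    (fun B hB hαB => hlcap B hB Δ hΔ ⟨α, Finset.mem_inter.2 ⟨hαB, hα⟩⟩)
  have hc := cell_card_mul 𝓑 𝓒 Finset.univ k lam ℓ hlam hk2.le (by omega) hkcard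
    (fun B _ => Finset.subset_univ B) (fun α _ β _ => hpairs α β) hpart hlcap
    (fun Δ hΔ => by rw [Finset.univ_inter]; exact hne Δ hΔ) hΔ
  rw [Finset.univ_inter, hccard Δ hΔ] at hc
  rw [hccard Δ hΔ] at hr2
  obtain ⟨r, hrα⟩ : ∃ r, r = (𝓑.filter (fun B => α ∈ B)).card := ⟨_, rfl⟩
  have hr : ∀ ω, (𝓑.filter (fun B => ω ∈ B)).card = r := fun ω =>
    Nat.eq_of_mul_eq_mul_right (by omega : 0 < k - 1)
      (by rw [hrα, ← hr1 ω, hr1 α])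
  rw [← hrα] at hr2
  have hlt : lam < r := by
    have h := hr1 α
    rw [← hrα] at h
    by_contra hcon
    have h1 : r * (k - 1) ≤ lam * (k - 1) := Nat.mul_le_mul_right _ (by omega)
    have h2 : lam * (k - 1) < lam * (Fintype.card Ω - 1) :=
      Nat.mul_lt_mul_of_pos_left (by omega) (by omega)
    omega
  have hkr := block_card_le_replication 𝓑 k r lam hkcard hr hpairs hlt (by omega)
  have hck : c ≤ k := by
    have hdvd : (c : ℤ) ∣ (k : ℤ) - ℓ := ⟨_, hc.symm⟩
    have := Int.le_of_dvd (by omega) hdvd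
    omega
  by_contra hcon
  have h1 : lam * (c - 1) ≤ (ℓ - 1) * (c - 1) := Nat.mul_le_mul_right _ (by omega)
  have h2 : (ℓ - 1) * (c - 1) < (ℓ - 1) * r := Nat.mul_lt_mul_of_pos_left (by omega) (by omega)
  rw [mul_comm (ℓ - 1) r] at h2
  omega

end Counting

/-- A maximal `p`-subgroup of a finite group whose order is divisible by `p` is nontrivial. -/
theorem ne_bot_of_maximal_isPGroup {p : ℕ} (hp : p.Prime) {H : Type*} [Group H] [Finite H]
    (K Q : Subgroup H) (hpK : p ∣ Nat.card K)
    (hQmax : ∀ Q' : Subgroup H, Q' ≤ K → IsPGroup p Q' → Q ≤ Q' → Q' = Q) : Q ≠ ⊥ := by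
  rintro rfl
  have := Fact.mk hp
  obtain ⟨x, hx⟩ := exists_prime_orderOf_dvd_card' p hpK
  have hx' : orderOf (x : H) = p := by rw [Subgroup.orderOf_coe, hx]
  have hz : Subgroup.zpowers (x : H) = ⊥ := by
    refine hQmax _ (by rw [Subgroup.zpowers_le]; exact x.2) ?_ bot_le
    exact IsPGroup.of_card (n := 1) (by rw [Nat.card_zpowers, hx', pow_one])
  rw [Subgroup.zpowers_eq_bot] at hz
  rw [hz, orderOf_one] at hx'
  exact hp.one_lt.ne hx'

/-- A block-preserving `p`-group with `p > lam` that fixes each class of size `c`, `p ∤ c`, acts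
trivially: its fixed points form a subdesign with the same parameters `k`, `lam`, `ℓ`, and these
determine the number of fixed points in a class, which must therefore be `c`. -/
theorem eq_bot_of_isPGroup_of_lt {Ω : Type*} [Fintype Ω] [DecidableEq Ω]
    (𝓑 𝓒 : Finset (Finset Ω)) (k lam c ℓ : ℕ)
    (hlam : 1 ≤ lam) (hk2 : 2 < k) (hkv : k < Fintype.card Ω)
    (hkcard : ∀ B ∈ 𝓑, B.card = k)
    (hpairs : ∀ α β : Ω, α ≠ β → (𝓑.filter (fun B => α ∈ B ∧ β ∈ B)).card = lam)
    (hpart : ∀ ω : Ω, ∃! Δ, Δ ∈ 𝓒 ∧ ω ∈ Δ) (hd2 : 2 ≤ 𝓒.card)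
    (hccard : ∀ Δ ∈ 𝓒, Δ.card = c) (hc2 : 2 ≤ c) (hl2 : 2 ≤ ℓ)
    (hlcap : ∀ B ∈ 𝓑, ∀ Δ ∈ 𝓒, (B ∩ Δ).Nonempty → (B ∩ Δ).card = ℓ)
    {p : ℕ} (hp : p.Prime) (hpc : ¬ p ∣ c) (hplam : lam < p)
    (Q : Subgroup (Equiv.Perm Ω)) (hQp : IsPGroup p Q)
    (hQB : ∀ g ∈ Q, ∀ B ∈ 𝓑, B.image g ∈ 𝓑)
    (hQC : ∀ g ∈ Q, ∀ Δ ∈ 𝓒, Δ.image g = Δ) : Q = ⊥ := by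
  classical
  obtain ⟨hlk, hllam⟩ := inter_card_lt_and_le 𝓑 𝓒 k lam c ℓ hlam hk2 hkv hkcard hpairs hpart hd2
    hccard hc2 hl2 hlcap
  let F : Finset Ω := Finset.univ.filter (fun ω => ∀ g ∈ Q, g ω = ω)
  have hF : ∀ ω, ω ∈ F ↔ ∀ g ∈ Q, g ω = ω := fun ω => by simp [F]
  have hmemC : ∀ g ∈ Q, ∀ Δ ∈ 𝓒, ∀ ω ∈ Δ, g ω ∈ Δ := fun g hg Δ hΔ ω hω => by
    have := Finset.mem_image_of_mem g hω
    rwa [hQC g hg Δ hΔ] at this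
  have hFne : ∀ Δ ∈ 𝓒, (F ∩ Δ).Nonempty := by
    intro Δ hΔ
    obtain ⟨ω, hω, hfix⟩ := hQp.exists_fixed_mem_of_not_dvd_card hp Δ
      (fun g ω hω => hmemC g g.2 Δ hΔ ω hω) (by rwa [hccard Δ hΔ])
    exact ⟨ω, Finset.mem_inter.2 ⟨(hF ω).2 fun g hg => hfix ⟨g, hg⟩, hω⟩⟩
  have hblock : ∀ α ∈ F, ∀ β ∈ F, α ≠ β → ∀ B ∈ 𝓑, α ∈ B → β ∈ B → B ⊆ F := by
    intro α hα β hβ hαβ B hB hαB hβB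
    rw [hF] at hα hβ
    have hBfix : ∀ g ∈ Q, B.image g = B := by
      intro g hg
      refine hQp.smul_eq_of_card_lt hp (𝓑.filter (fun B => α ∈ B ∧ β ∈ B)) ?_
        (by rwa [hpairs α β hαβ]) (Finset.mem_filter.2 ⟨hB, hαB, hβB⟩) ⟨g, hg⟩
      intro h A hA
      obtain ⟨hA, hαA, hβA⟩ := Finset.mem_filter.1 hA
      refine Finset.mem_filter.2 ⟨hQB h h.2 A hA, ?_, ?_⟩
      · exact Finset.mem_image.2 ⟨α, hαA, hα h h.2⟩
      · exact Finset.mem_image.2 ⟨β, hβA, hβ h h.2⟩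
    intro ω hω
    rw [hF]
    intro g hg
    obtain ⟨Δ, ⟨hΔ, hωΔ⟩, -⟩ := hpart ω
    have hωB : ω ∈ B ∩ Δ := Finset.mem_inter.2 ⟨hω, hωΔ⟩
    refine hQp.smul_eq_of_card_lt hp (B ∩ Δ) ?_
      (by rw [hlcap B hB Δ hΔ ⟨ω, hωB⟩]; omega) hωB ⟨g, hg⟩
    intro h x hx
    obtain ⟨hxB, hxΔ⟩ := Finset.mem_inter.1 hx
    refine Finset.mem_inter.2 ⟨?_, hmemC h h.2 Δ hΔ x hxΔ⟩
    have := Finset.mem_image_of_mem (h : Equiv.Perm Ω) hxB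
    rwa [hBfix h h.2] at this
  have hFC : ∀ Δ ∈ 𝓒, F ∩ Δ = Δ := by
    intro Δ hΔ
    have hc := cell_card_mul 𝓑 𝓒 Finset.univ k lam ℓ hlam hk2.le (by omega) hkcard
      (fun B _ => Finset.subset_univ B) (fun α _ β _ => hpairs α β) hpart hlcap
      (fun Δ hΔ => (hFne Δ hΔ).mono (Finset.inter_subset_inter_right (Finset.subset_univ F))) hΔ
    have hf := cell_card_mul (𝓑.filter (fun B => B ⊆ F)) 𝓒 F k lam ℓ hlam hk2.le (by omega)
      (fun B hB => hkcard B (Finset.mem_filter.1 hB).1)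
      (fun B hB => (Finset.mem_filter.1 hB).2)
      (fun α hα β hβ hαβ => by
        rw [← hpairs α β hαβ, Finset.filter_filter]
        congr 1
        refine Finset.filter_congr fun B hB => ?_
        exact ⟨fun h => h.2, fun h => ⟨hblock α hα β hβ hαβ B hB h.1 h.2, h⟩⟩)
      hpart (fun B hB => hlcap B (Finset.mem_filter.1 hB).1) hFne hΔ
    rw [Finset.univ_inter] at hc
    have hn : (k : ℤ) - 1 - 𝓒.card * ((ℓ : ℤ) - 1) ≠ 0 := by
      intro h0
      rw [h0, mul_zero] at hc
      omega
    have hcard : Δ.card = (F ∩ Δ).card := by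
      exact_mod_cast mul_right_cancel₀ hn (hc.trans hf.symm)
    exact Finset.eq_of_subset_of_card_le Finset.inter_subset_right hcard.le
  rw [Subgroup.eq_bot_iff_forall]
  intro g hg
  ext ω
  obtain ⟨Δ, ⟨hΔ, hωΔ⟩, -⟩ := hpart ω
  rw [← hFC Δ hΔ, Finset.mem_inter, hF] at hωΔ
  exact hωΔ.1 g hg

theorem stmt_13
    {Ω : Type*} [Fintype Ω] [DecidableEq Ω]
    (v k lam c d ℓ : ℕ)
    (𝓑 𝓒 : Finset (Finset Ω))
    (G : Subgroup (Equiv.Perm Ω))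
    (hv : Fintype.card Ω = v)
    (hlam1 : 1 ≤ lam)
    (hkcard : ∀ B ∈ 𝓑, B.card = k)
    (hpairs : ∀ α β : Ω, α ≠ β → (𝓑.filter (fun B => α ∈ B ∧ β ∈ B)).card = lam)
    (hk2 : 2 < k) (hkv : k < v)
    (hGB : ∀ g ∈ G, ∀ B ∈ 𝓑, B.image ⇑g ∈ 𝓑)
    (hflag : ∀ B₁ ∈ 𝓑, ∀ B₂ ∈ 𝓑, ∀ α₁ ∈ B₁, ∀ α₂ ∈ B₂,
        ∃ g ∈ G, B₁.image ⇑g = B₂ ∧ g α₁ = α₂)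
    (hpart : ∀ ω : Ω, ∃! Δ, Δ ∈ 𝓒 ∧ ω ∈ Δ)
    (hdcard : 𝓒.card = d) (hd2 : 2 ≤ d)
    (hccard : ∀ Δ ∈ 𝓒, Δ.card = c) (hc2 : 2 ≤ c)
    (hGC : ∀ g ∈ G, ∀ Δ ∈ 𝓒, Δ.image ⇑g ∈ 𝓒)
    (hl2 : 2 ≤ ℓ)
    (hlcap : ∀ B ∈ 𝓑, ∀ Δ ∈ 𝓒, (B ∩ Δ).Nonempty → (B ∩ Δ).card = ℓ)
    (p : ℕ) (hp : p.Prime)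
    -- K is the kernel of the action of G on 𝓒
    (K : Subgroup (Equiv.Perm Ω))
    (hK : ∀ g : Equiv.Perm Ω, g ∈ K ↔ (g ∈ G ∧ ∀ Δ ∈ 𝓒, Δ.image ⇑g = Δ))
    (hpK : p ∣ Nat.card ↥K) (hpc : ¬ p ∣ c) (hplam : lam < p)
    -- Q is a Sylow p-subgroup of K (a maximal p-subgroup of K)
    (Q : Subgroup (Equiv.Perm Ω)) (hQK : Q ≤ K) (hQp : IsPGroup p ↥Q)
    (hQmax : ∀ Q' : Subgroup (Equiv.Perm Ω), Q' ≤ K → IsPGroup p ↥Q' → Q ≤ Q' → Q' = Q)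
    : ∃ f : ℕ, ℓ < f ∧ f < c ∧ c ≡ f [MOD p] ∧
      -- Q fixes exactly f points in every class
      (∀ Δ ∈ 𝓒, Set.ncard {ω : Ω | ω ∈ Δ ∧ ∀ g ∈ Q, g ω = ω} = f) ∧
      -- (fix(Q), 𝓑₀) is a 2-(df, k, λ) design
      Set.ncard {ω : Ω | ∀ g ∈ Q, g ω = ω} = d * f ∧
      (∀ α β : Ω, (∀ g ∈ Q, g α = α) → (∀ g ∈ Q, g β = β) → α ≠ β →
        Set.ncard {B : Finset Ω | B ∈ 𝓑 ∧ α ∈ B ∧ β ∈ B ∧ ∀ ω ∈ B, ∀ g ∈ Q, g ω = ω} = lam) ∧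
      (k - 1) ∣ lam * (d * f - 1) := by
  refine absurd ?_ (ne_bot_of_maximal_isPGroup hp K Q hpK hQmax)
  exact eq_bot_of_isPGroup_of_lt 𝓑 𝓒 k lam c ℓ hlam1 hk2 (hv ▸ hkv) hkcard hpairs hpart
    (hdcard ▸ hd2) hccard hc2 hl2 hlcap hp hpc hplam Q hQp
    (fun g hg => hGB g ((hK g).1 (hQK hg)).1) (fun g hg => ((hK g).1 (hQK hg)).2)
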